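/- arXiv:2209.13606 — 2 statements merged into one kernel-verified Lean document; each statement's English description precedes it below -/
import Mathlib

section
/- Given discretization meshes X̂_t with sizes δ_{X,t} satisfying the resolution conditions, for every t ∈ {1,…,T}, every i_{t−1} ∈ V, every neighbor i_t ∈ N(i_{t−1}) and every mesh point x̂ ∈ X̂_{t−1} ∩ Q_{t−1}^{(i_{t−1})}, the discretized value functions satisfy U_t(x̂, i_{t−1}) ≤ Û_t(x̂, i_{t−1}) ≤ U_t(x̂, i_{t−1}) + Σ_{τ=t}^{T−1} (L_c + L_{v,τ+1}) δ_{X,τ} + L_c · δ_{X,T}, and V_t(x̂, i_t) ≤ V̂_t(x̂, i_t) ≤ V_t(x̂, i_t) + Σ_{τ=t}^{T−1} (L_c + L_{v,τ+1}) δ_{X,τ} + L_c · δ_{X,T}, where L_{v,t} = L_c · Σ_{k=1}^{T−t+1} (1 + L_Θ)^k. -/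
lemma aux_sInf {E F : Type*} (S : Set E) (S' : Set F) (f : E → ℝ) (g : F → ℝ) (K : ℝ)
    (hS : S.Nonempty) (hg : ∀ y ∈ S', 0 ≤ g y)
    (h : ∀ y ∈ S, ∃ y' ∈ S', g y' ≤ f y + K) :
    sInf (g '' S') ≤ sInf (f '' S) + K := by
  rw [← sub_le_iff_le_add]
  apply le_csInf (hS.image f)
  rintro _ ⟨y, hy, rfl⟩
  obtain ⟨y', hy', hle⟩ := h y hy
  have hb : BddBelow (g '' S') := ⟨0, by rintro _ ⟨z, hz, rfl⟩; exact hg z hz⟩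
  have := csInf_le hb (Set.mem_image_of_mem g hy')
  linarith

lemma aux_sup {ι : Type*} (s : Finset ι) (hs : s.Nonempty) (f g : ι → ℝ) (K : ℝ)
    (h : ∀ j ∈ s, f j ≤ g j + K) : s.sup' hs f ≤ s.sup' hs g + K := by
  apply Finset.sup'_le
  intro j hj
  have := Finset.le_sup' g hj
  linarith [h j hj]

lemma aux_step {E : Type*} [MetricSpace E] (X P Q Xp Xq : Set E) (R : E → Set E) (c : E → E → ℝ)
    (Lc LΘ Lw δ e : ℝ) (hLc : 0 ≤ Lc) (hLw : 0 ≤ Lw)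
    (hPX : P ⊆ X) (hQX : Q ⊆ X) (hQc : IsCompact Q) (hRc : ∀ x ∈ X, IsCompact (R x))
    (hc0 : ∀ x ∈ X, ∀ y ∈ X, 0 ≤ c x y)
    (hcLip : ∀ x ∈ X, ∀ x' ∈ X, ∀ y ∈ X, ∀ y' ∈ X,
        |c x y - c x' y'| ≤ Lc * (dist x x' + dist y y'))
    (hne : ∀ x ∈ P, (R x ∩ Q).Nonempty)
    (hΘ : ∀ x ∈ P, ∀ x' ∈ P, Metric.hausdorffDist (R x ∩ Q) (R x' ∩ Q) ≤ LΘ * dist x x')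
    (hmesh : ∀ xh ∈ Xp ∩ P, ∀ x ∈ R xh ∩ Q, ∃ yh ∈ Xq ∩ R xh ∩ Q, dist yh x ≤ δ)
    (w wh : E → ℝ) (hw0 : ∀ y ∈ Q, 0 ≤ w y)
    (hwL : ∀ y ∈ Q, ∀ y' ∈ Q, w y' ≤ w y + Lw * dist y y')
    (hw1 : ∀ y ∈ Xq ∩ Q, w y ≤ wh y) (hw2 : ∀ y ∈ Xq ∩ Q, wh y ≤ w y + e)
    (v vh : E → ℝ) (hv : ∀ x, v x = sInf ((fun y => c x y + w y) '' (R x ∩ Q)))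
    (hvh : ∀ x, vh x = sInf ((fun y => c x y + wh y) '' (Xq ∩ R x ∩ Q))) :
    (∀ x ∈ P, 0 ≤ v x) ∧
    (∀ x ∈ P, ∀ x' ∈ P, v x' ≤ v x + (Lc * (1 + LΘ) + LΘ * Lw) * dist x x') ∧
    (∀ x ∈ Xp ∩ P, v x ≤ vh x) ∧
    (∀ x ∈ Xp ∩ P, vh x ≤ v x + ((Lc + Lw) * δ + e)) := by
  have pos : ∀ x ∈ P, ∀ y ∈ R x ∩ Q, 0 ≤ c x y + w y := fun x hx y hy =>
    add_nonneg (hc0 x (hPX hx) y (hQX hy.2)) (hw0 y hy.2)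
  refine ⟨?_, ?_, ?_, ?_⟩
  · intro x hx
    rw [hv]
    apply Real.sInf_nonneg
    rintro _ ⟨y, hy, rfl⟩
    exact pos x hx y hy
  · intro x hx x' hx'
    rw [hv, hv]
    apply aux_sInf _ _ _ _ _ (hne x hx) (pos x' hx')
    intro y hy
    have hcx : IsCompact (R x ∩ Q) := (hRc x (hPX hx)).inter hQc
    have hcx' : IsCompact (R x' ∩ Q) := (hRc x' (hPX hx')).inter hQc
    obtain ⟨y', hy', hd⟩ := hcx'.exists_infDist_eq_dist (hne x' hx') y
    have h1 := Metric.infDist_le_hausdorffDist_of_mem hy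
      (Metric.hausdorffEDist_ne_top_of_nonempty_of_bounded (hne x hx) (hne x' hx')
        hcx.isBounded hcx'.isBounded)
    have h2 : dist y y' ≤ LΘ * dist x x' := by
      rw [← hd]; exact h1.trans (hΘ x hx x' hx')
    refine ⟨y', hy', ?_⟩
    have h3 := abs_le.1 (hcLip x (hPX hx) x' (hPX hx') y (hQX hy.2) y' (hQX hy'.2))
    have h4 := hwL y hy.2 y' hy'.2
    have h5 := mul_le_mul_of_nonneg_left h2 hLc
    have h6 := mul_le_mul_of_nonneg_left h2 hLw
    linarith [h3.1]
  · intro x hx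
    rw [hv, hvh]
    obtain ⟨y, hy⟩ := hne x hx.2
    obtain ⟨z, hz, -⟩ := hmesh x hx y hy
    have := aux_sInf (Xq ∩ R x ∩ Q) (R x ∩ Q) (fun y => c x y + wh y) (fun y => c x y + w y) 0
      ⟨z, hz⟩ (pos x hx.2) (fun y hy => ⟨y, ⟨hy.1.2, hy.2⟩, by
        have := hw1 y ⟨hy.1.1, hy.2⟩
        linarith⟩)
    linarith
  · intro x hx
    rw [hv, hvh]
    apply aux_sInf _ _ _ _ _ (hne x hx.2)
    · intro y hy
      have := hw1 y ⟨hy.1.1, hy.2⟩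
      have := pos x hx.2 y ⟨hy.1.2, hy.2⟩
      linarith
    · intro y hy
      obtain ⟨z, hz, hd⟩ := hmesh x hx y hy
      refine ⟨z, hz, ?_⟩
      have h3 := abs_le.1 (hcLip x (hPX hx.2) x (hPX hx.2) y (hQX hy.2) z (hQX hz.2))
      have h4 := hwL y hy.2 z hz.2
      have h7 := hw2 z ⟨hz.1.1, hz.2⟩
      rw [dist_comm] at hd
      have h5 := mul_le_mul_of_nonneg_left hd hLc
      have h6 := mul_le_mul_of_nonneg_left hd hLw
      rw [dist_self, zero_add] at h3
      linarith [h3.1]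

/-- Discretization error bound for adversarial convex body chasing: for meshes
`X̂ t` with resolutions `δX t` satisfying the resolution conditions, the discretized
value functions `V̂, Û` satisfy
`U t xh i' ≤ Û t xh i' ≤ U t xh i' + Σ_{τ=t}^{T−1} (L_c + L_{v,τ+1}) δX τ + L_c δX T`
and likewise for `V`, where `L_{v,s} = L_c · Σ_{k=1}^{T−s+1} (1 + L_Θ)^k`. -/
theorem stmt_4 {N : ℕ} (X : Set (EuclideanSpace ℝ (Fin N)))
    {ι : Type*} [Fintype ι]
    (Nbr : ι → Finset ι) (hNbr : ∀ i, (Nbr i).Nonempty)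
    (T : ℕ) (hT : 1 ≤ T)
    (Q : ℕ → ι → Set (EuclideanSpace ℝ (Fin N)))
    (hQne : ∀ t ≤ T, ∀ i, (Q t i).Nonempty)
    (hQcomp : ∀ t ≤ T, ∀ i, IsCompact (Q t i))
    (hQconv : ∀ t ≤ T, ∀ i, Convex ℝ (Q t i))
    (hQsub : ∀ t ≤ T, ∀ i, Q t i ⊆ X)
    (R : EuclideanSpace ℝ (Fin N) → Set (EuclideanSpace ℝ (Fin N)))
    (hRcomp : ∀ x ∈ X, IsCompact (R x))
    (hRsub : ∀ x ∈ X, R x ⊆ X)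
    (hRcont : ∀ x ∈ X, ∀ ε > (0 : ℝ), ∃ δ > (0 : ℝ), ∀ x' ∈ X, dist x x' < δ →
        Metric.hausdorffDist (R x) (R x') < ε)
    (c : EuclideanSpace ℝ (Fin N) → EuclideanSpace ℝ (Fin N) → ℝ)
    (hcnonneg : ∀ x ∈ X, ∀ y ∈ X, 0 ≤ c x y)
    (Lc LΘ : ℝ) (hLc : 0 ≤ Lc) (hLΘ : 0 ≤ LΘ)
    (hcLip : ∀ x ∈ X, ∀ x' ∈ X, ∀ y ∈ X, ∀ y' ∈ X,
        |c x y - c x' y'| ≤ Lc * (dist x x' + dist y y'))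
    (hΘLip : ∀ t ≤ T, ∀ i : ι, ∀ x ∈ X, ∀ x' ∈ X,
        (R x ∩ Q t i).Nonempty → (R x' ∩ Q t i).Nonempty →
        Metric.hausdorffDist (R x ∩ Q t i) (R x' ∩ Q t i) ≤ LΘ * dist x x')
    (hfeas : ∀ t < T, ∀ i, ∀ x ∈ Q t i, ∀ j ∈ Nbr i,
        (interior (R x ∩ Q (t + 1) j)).Nonempty)
    (V U : ℕ → EuclideanSpace ℝ (Fin N) → ι → ℝ)
    (hVT : ∀ x i, V T x i = sInf ((fun y => c x y) '' (R x ∩ Q T i)))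
    (hVt : ∀ t, 1 ≤ t → t < T → ∀ x i,
        V t x i = sInf ((fun y =>
          c x y + (Nbr i).sup' (hNbr i) (fun j => V (t + 1) y j)) '' (R x ∩ Q t i)))
    (hUT : ∀ x i, U T x i =
        (Nbr i).sup' (hNbr i) (fun j => sInf ((fun y => c x y) '' (R x ∩ Q T j))))
    (hUt : ∀ t, 1 ≤ t → t < T → ∀ x i,
        U t x i = (Nbr i).sup' (hNbr i) (fun j =>
          sInf ((fun y => c x y + U (t + 1) y j) '' (R x ∩ Q t j))))
    (Xh : ℕ → Set (EuclideanSpace ℝ (Fin N)))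
    (hXhfin : ∀ t ≤ T, (Xh t).Finite)
    (hXhsub : ∀ t ≤ T, Xh t ⊆ X)
    (δX : ℕ → ℝ) (hδpos : ∀ t ≤ T, 0 < δX t)
    (hmeshA : ∀ t ≤ T, ∀ x ∈ X, ∃ xh ∈ Xh t, dist xh x ≤ δX t)
    (hmeshB : ∀ i : ι, ∀ x ∈ Q 0 i, ∃ xh ∈ Xh 0 ∩ Q 0 i, dist xh x ≤ δX 0)
    (hmeshC : ∀ t, 1 ≤ t → t ≤ T → ∀ i' i : ι, i ∈ Nbr i' →
        ∀ xh ∈ Xh (t - 1) ∩ Q (t - 1) i', ∀ x ∈ R xh ∩ Q t i,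
          ∃ yh ∈ Xh t ∩ R xh ∩ Q t i, dist yh x ≤ δX t)
    (Vh Uh : ℕ → EuclideanSpace ℝ (Fin N) → ι → ℝ)
    (hVhT : ∀ x i, Vh T x i = sInf ((fun y => c x y) '' (Xh T ∩ R x ∩ Q T i)))
    (hVht : ∀ t, 1 ≤ t → t < T → ∀ x i,
        Vh t x i = sInf ((fun y =>
          c x y + (Nbr i).sup' (hNbr i) (fun j => Vh (t + 1) y j))
            '' (Xh t ∩ R x ∩ Q t i)))
    (hUhT : ∀ x i, Uh T x i = (Nbr i).sup' (hNbr i)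
        (fun j => sInf ((fun y => c x y) '' (Xh T ∩ R x ∩ Q T j))))
    (hUht : ∀ t, 1 ≤ t → t < T → ∀ x i,
        Uh t x i = (Nbr i).sup' (hNbr i) (fun j =>
          sInf ((fun y => c x y + Uh (t + 1) y j) '' (Xh t ∩ R x ∩ Q t j))))
    (t : ℕ) (ht1 : 1 ≤ t) (htT : t ≤ T)
    (i' it : ι) (hit : it ∈ Nbr i') :
    ∀ xh ∈ Xh (t - 1) ∩ Q (t - 1) i',
      (U t xh i' ≤ Uh t xh i' ∧
        Uh t xh i' ≤ U t xh i'
          + ∑ τ ∈ Finset.Ico t T,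
              (Lc + Lc * ∑ k ∈ Finset.Icc 1 (T - (τ + 1) + 1), (1 + LΘ) ^ k) * δX τ
          + Lc * δX T) ∧
      (V t xh it ≤ Vh t xh it ∧
        Vh t xh it ≤ V t xh it
          + ∑ τ ∈ Finset.Ico t T,
              (Lc + Lc * ∑ k ∈ Finset.Icc 1 (T - (τ + 1) + 1), (1 + LΘ) ^ k) * δX τ
          + Lc * δX T) := by
  have hUV : ∀ n t, t + n = T → 1 ≤ t → ∀ x i,
      U t x i = (Nbr i).sup' (hNbr i) (fun j => V t x j) := by
    intro n
    induction n with
    | zero =>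
      intro t h h1 x i
      obtain rfl : t = T := by omega
      rw [hUT]; simp only [hVT]
    | succ n ih =>
      intro t h h1 x i
      rw [hUt t h1 (by omega)]
      simp only [hVt t h1 (by omega), ih (t + 1) (by omega) (by omega)]
  have hUVh : ∀ n t, t + n = T → 1 ≤ t → ∀ x i,
      Uh t x i = (Nbr i).sup' (hNbr i) (fun j => Vh t x j) := by
    intro n
    induction n with
    | zero =>
      intro t h h1 x i
      obtain rfl : t = T := by omega
      rw [hUhT]; simp only [hVhT]
    | succ n ih =>
      intro t h h1 x i
      rw [hUht t h1 (by omega)]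
      simp only [hVht t h1 (by omega), ih (t + 1) (by omega) (by omega)]
  set L : ℕ → ℝ := fun m => Lc * ∑ k ∈ Finset.Icc 1 m, (1 + LΘ) ^ k with hL
  have hL0 : ∀ m, 0 ≤ L m := fun m =>
    mul_nonneg hLc (Finset.sum_nonneg fun k _ => pow_nonneg (by linarith) k)
  have hLs : ∀ m, L (m + 1) = Lc * (1 + LΘ) + (1 + LΘ) * L m := by
    intro m
    induction m with
    | zero => simp [hL]
    | succ m ih =>
      have e : ∀ p, L (p + 1) = L p + Lc * (1 + LΘ) ^ (p + 1) := by
        intro p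
        simp only [hL]
        rw [Finset.sum_Icc_succ_top (by omega)]
        ring
      rw [e (m + 1)]
      nth_rewrite 2 [e m]
      rw [ih]
      ring
  set Er : ℕ → ℝ := fun t => ∑ τ ∈ Finset.Ico t T, (Lc + L (T - (τ + 1) + 1)) * δX τ + Lc * δX T
    with hEr
  have key : ∀ n t, t + n = T → 1 ≤ t → ∀ i' i, i ∈ Nbr i' →
      (∀ x ∈ Q (t - 1) i', 0 ≤ V t x i) ∧
      (∀ x ∈ Q (t - 1) i', ∀ x' ∈ Q (t - 1) i', V t x' i ≤ V t x i + L (n + 1) * dist x x') ∧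
      (∀ x ∈ Xh (t - 1) ∩ Q (t - 1) i', V t x i ≤ Vh t x i) ∧
      (∀ x ∈ Xh (t - 1) ∩ Q (t - 1) i', Vh t x i ≤ V t x i + Er t) := by
    intro n
    induction n with
    | zero =>
      intro t h h1 i' i hi
      obtain rfl : t = T := by omega
      have hne : ∀ x ∈ Q (t - 1) i', (R x ∩ Q t i).Nonempty := by
        intro x hx
        have := hfeas (t - 1) (by omega) i' x hx i hi
        rw [Nat.sub_add_cancel h1] at this
        exact this.mono interior_subset
      have := aux_step X (Q (t - 1) i') (Q t i) (Xh (t - 1)) (Xh t) R c Lc LΘ 0 (δX t) 0 hLc le_rfl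
        (hQsub _ (by omega) _) (hQsub _ (by omega) _) (hQcomp _ (by omega) _) hRcomp hcnonneg hcLip
        hne (fun x hx x' hx' => hΘLip t (by omega) i x (hQsub _ (by omega) _ hx) x'
          (hQsub _ (by omega) _ hx') (hne x hx) (hne x' hx'))
        (hmeshC t h1 (by omega) i' i hi) (fun _ => 0) (fun _ => 0)
        (by simp) (by simp) (by simp) (by simp) (fun x => V t x i) (fun x => Vh t x i)
        (by simp [hVT]) (by simp [hVhT])
      refine ⟨this.1, ?_, this.2.2.1, ?_⟩
      · simpa [hL] using this.2.1
      · simpa [hEr] using this.2.2.2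
    | succ n ih =>
      intro t h h1 i' i hi
      have hne : ∀ x ∈ Q (t - 1) i', (R x ∩ Q t i).Nonempty := by
        intro x hx
        have := hfeas (t - 1) (by omega) i' x hx i hi
        rw [Nat.sub_add_cancel h1] at this
        exact this.mono interior_subset
      have ih' := ih (t + 1) (by omega) (by omega) i
      simp only [Nat.add_sub_cancel] at ih'
      have := aux_step X (Q (t - 1) i') (Q t i) (Xh (t - 1)) (Xh t) R c Lc LΘ (L (n + 1)) (δX t)
        (Er (t + 1)) hLc (hL0 _)
        (hQsub _ (by omega) _) (hQsub _ (by omega) _) (hQcomp _ (by omega) _) hRcomp hcnonneg hcLip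
        hne (fun x hx x' hx' => hΘLip t (by omega) i x (hQsub _ (by omega) _ hx) x'
          (hQsub _ (by omega) _ hx') (hne x hx) (hne x' hx'))
        (hmeshC t h1 (by omega) i' i hi)
        (fun y => (Nbr i).sup' (hNbr i) (fun j => V (t + 1) y j))
        (fun y => (Nbr i).sup' (hNbr i) (fun j => Vh (t + 1) y j))
        (by
          intro y hy
          obtain ⟨j, hj⟩ := hNbr i
          exact ((ih' j hj).1 y hy).trans (Finset.le_sup' (fun j => V (t + 1) y j) hj))
        (fun y hy y' hy' => aux_sup _ _ _ _ _ fun j hj => (ih' j hj).2.1 y hy y' hy')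
        (by
          intro y hy
          have := aux_sup (Nbr i) (hNbr i) (fun j => V (t + 1) y j) (fun j => Vh (t + 1) y j) 0
            (fun j hj => by simpa using (ih' j hj).2.2.1 y hy)
          simpa only [add_zero] using this)
        (fun y hy => aux_sup _ _ _ _ _ fun j hj => (ih' j hj).2.2.2 y hy)
        (fun x => V t x i) (fun x => Vh t x i)
        (fun x => hVt t h1 (by omega) x i) (fun x => hVht t h1 (by omega) x i)
      refine ⟨this.1, ?_, this.2.2.1, ?_⟩
      · intro x hx x' hx'
        refine (this.2.1 x hx x' hx').trans ?_
        gcongr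
        rw [hLs (n + 1)]
        linarith [hL0 (n + 1)]
      · intro x hx
        refine (this.2.2.2 x hx).trans (le_of_eq ?_)
        simp only [hEr]
        rw [Finset.sum_eq_sum_Ico_succ_bot (by omega : t < T)]
        rw [show T - (t + 1) + 1 = n + 1 by omega]
        ring
  intro xh hxh
  have k := fun j hj => key (T - t) t (by omega) ht1 i' j hj
  have e1 := hUV (T - t) t (by omega) ht1 xh i'
  have e2 := hUVh (T - t) t (by omega) ht1 xh i'
  have g1 := aux_sup (Nbr i') (hNbr i') (fun j => V t xh j) (fun j => Vh t xh j) 0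
    (fun j hj => by simpa using (k j hj).2.2.1 xh hxh)
  have g2 := aux_sup (Nbr i') (hNbr i') (fun j => Vh t xh j) (fun j => V t xh j) (Er t)
    (fun j hj => (k j hj).2.2.2 xh hxh)
  rw [← e1, ← e2] at g1 g2
  have g3 := (k it hit).2.2.1 xh hxh
  have g4 := (k it hit).2.2.2 xh hxh
  simp only [hEr] at g2 g4
  refine ⟨⟨by linarith, ?_⟩, g3, ?_⟩
  · rw [add_assoc]; exact g2
  · rw [add_assoc]; exact g4
end

section
/- Given discretization meshes X̂_t with sizes δ_{X,t} satisfying the resolution conditions, the game value after discretization satisfies U_0(G, Q) ≤ Û_0(G, Q) ≤ U_0(G, Q) + E(δ_X), where E(δ_X) = Σ_{τ=1}^{T−1} (L_c + L_{v,τ+1}) δ_{X,τ} + L_{v,1} · δ_{X,0} + L_c · δ_{X,T}, with L_{v,t} = L_c · Σ_{k=1}^{T−t+1} (1 + L_Θ)^k. -/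
open Finset in
theorem aux_sup_le {E ι : Type*} (s : Finset ι) (hs : s.Nonempty) (A B : ι → Set E)
    (f g : ι → E → ℝ) (e : ℝ)
    (hB : ∀ j ∈ s, (B j).Nonempty)
    (hf : ∀ j ∈ s, ∀ x ∈ A j, 0 ≤ f j x)
    (h : ∀ j ∈ s, ∀ y ∈ B j, ∃ x ∈ A j, f j x ≤ g j y + e) :
    s.sup' hs (fun j => sInf (f j '' A j)) ≤ s.sup' hs (fun j => sInf (g j '' B j)) + e := by
  apply Finset.sup'_le
  intro j hj
  have h1 : sInf (f j '' A j) - e ≤ sInf (g j '' B j) := by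
    apply le_csInf ((hB j hj).image _)
    rintro _ ⟨y, hy, rfl⟩
    obtain ⟨x, hx, hxy⟩ := h j hj y hy
    have : sInf (f j '' A j) ≤ f j x := by
      apply csInf_le
      · refine ⟨0, ?_⟩
        rintro _ ⟨z, hz, rfl⟩
        exact hf j hj z hz
      · exact ⟨x, hx, rfl⟩
    linarith
  have h2 := Finset.le_sup' (fun j => sInf (g j '' B j)) hj
  linarith

theorem aux_sup_nonneg {E ι : Type*} (s : Finset ι) (hs : s.Nonempty) (A : ι → Set E)
    (f : ι → E → ℝ) (hf : ∀ j ∈ s, ∀ x ∈ A j, 0 ≤ f j x) :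
    0 ≤ s.sup' hs (fun j => sInf (f j '' A j)) := by
  obtain ⟨j, hj⟩ := hs
  refine le_trans ?_ (Finset.le_sup' (fun j => sInf (f j '' A j)) hj)
  apply Real.sInf_nonneg
  rintro _ ⟨z, hz, rfl⟩
  exact hf j hj z hz

theorem aux_near {E : Type*} [MetricSpace E] {A B : Set E} (hA : IsCompact A) (hB : IsCompact B)
    (hA' : A.Nonempty) (hB' : B.Nonempty) {r : ℝ} (h : Metric.hausdorffDist A B ≤ r)
    {y : E} (hy : y ∈ A) : ∃ z ∈ B, dist y z ≤ r := by
  obtain ⟨z, hz, hd⟩ := hB.exists_infDist_eq_dist hB' y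
  refine ⟨z, hz, ?_⟩
  rw [← hd]
  exact (Metric.infDist_le_hausdorffDist_of_mem hy
    (Metric.hausdorffEDist_ne_top_of_nonempty_of_bounded hA' hB' hA.isBounded hB.isBounded)).trans h

theorem aux_geom (a L : ℝ) (n : ℕ) :
    L * ∑ k ∈ Finset.Icc 1 (n + 1), a ^ k = a * (L + L * ∑ k ∈ Finset.Icc 1 n, a ^ k) := by
  induction n with
  | zero => simp; ring
  | succ n ih =>
    have h := Finset.sum_Icc_succ_top (by omega : 1 ≤ n + 1) (fun k => a ^ k)
    rw [Finset.sum_Icc_succ_top (by omega), mul_add, ih, ← sub_eq_zero]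
    rw [h] at ih
    linear_combination a * ih

/-- Discretized game value bound for adversarial convex body chasing: the game value
after discretization satisfies `U₀ ≤ Û₀ ≤ U₀ + E(δX)` where
`E(δX) = Σ_{τ=1}^{T−1} (L_c + L_{v,τ+1}) δX τ + L_{v,1} δX 0 + L_c δX T` and
`L_{v,s} = L_c · Σ_{k=1}^{T−s+1} (1 + L_Θ)^k`. -/
theorem stmt_5 {N : ℕ} (X : Set (EuclideanSpace ℝ (Fin N)))
    {ι : Type*} [Fintype ι] [Nonempty ι]
    (Nbr : ι → Finset ι) (hNbr : ∀ i, (Nbr i).Nonempty)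
    (T : ℕ) (hT : 1 ≤ T)
    (Q : ℕ → ι → Set (EuclideanSpace ℝ (Fin N)))
    (hQne : ∀ t ≤ T, ∀ i, (Q t i).Nonempty)
    (hQcomp : ∀ t ≤ T, ∀ i, IsCompact (Q t i))
    (hQconv : ∀ t ≤ T, ∀ i, Convex ℝ (Q t i))
    (hQsub : ∀ t ≤ T, ∀ i, Q t i ⊆ X)
    (R : EuclideanSpace ℝ (Fin N) → Set (EuclideanSpace ℝ (Fin N)))
    (hRcomp : ∀ x ∈ X, IsCompact (R x))
    (hRsub : ∀ x ∈ X, R x ⊆ X)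
    (hRcont : ∀ x ∈ X, ∀ ε > (0 : ℝ), ∃ δ > (0 : ℝ), ∀ x' ∈ X, dist x x' < δ →
        Metric.hausdorffDist (R x) (R x') < ε)
    (c : EuclideanSpace ℝ (Fin N) → EuclideanSpace ℝ (Fin N) → ℝ)
    (hcnonneg : ∀ x ∈ X, ∀ y ∈ X, 0 ≤ c x y)
    (Lc LΘ : ℝ) (hLc : 0 ≤ Lc) (hLΘ : 0 ≤ LΘ)
    (hcLip : ∀ x ∈ X, ∀ x' ∈ X, ∀ y ∈ X, ∀ y' ∈ X,
        |c x y - c x' y'| ≤ Lc * (dist x x' + dist y y'))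
    (hΘLip : ∀ t ≤ T, ∀ i : ι, ∀ x ∈ X, ∀ x' ∈ X,
        (R x ∩ Q t i).Nonempty → (R x' ∩ Q t i).Nonempty →
        Metric.hausdorffDist (R x ∩ Q t i) (R x' ∩ Q t i) ≤ LΘ * dist x x')
    (hfeas : ∀ t < T, ∀ i, ∀ x ∈ Q t i, ∀ j ∈ Nbr i,
        (interior (R x ∩ Q (t + 1) j)).Nonempty)
    (V U : ℕ → EuclideanSpace ℝ (Fin N) → ι → ℝ)
    (hVT : ∀ x i, V T x i = sInf ((fun y => c x y) '' (R x ∩ Q T i)))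
    (hVt : ∀ t, 1 ≤ t → t < T → ∀ x i,
        V t x i = sInf ((fun y =>
          c x y + (Nbr i).sup' (hNbr i) (fun j => V (t + 1) y j)) '' (R x ∩ Q t i)))
    (hUT : ∀ x i, U T x i =
        (Nbr i).sup' (hNbr i) (fun j => sInf ((fun y => c x y) '' (R x ∩ Q T j))))
    (hUt : ∀ t, 1 ≤ t → t < T → ∀ x i,
        U t x i = (Nbr i).sup' (hNbr i) (fun j =>
          sInf ((fun y => c x y + U (t + 1) y j) '' (R x ∩ Q t j))))
    (Xh : ℕ → Set (EuclideanSpace ℝ (Fin N)))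
    (hXhfin : ∀ t ≤ T, (Xh t).Finite)
    (hXhsub : ∀ t ≤ T, Xh t ⊆ X)
    (δX : ℕ → ℝ) (hδpos : ∀ t ≤ T, 0 < δX t)
    (hmeshA : ∀ t ≤ T, ∀ x ∈ X, ∃ xh ∈ Xh t, dist xh x ≤ δX t)
    (hmeshB : ∀ i : ι, ∀ x ∈ Q 0 i, ∃ xh ∈ Xh 0 ∩ Q 0 i, dist xh x ≤ δX 0)
    (hmeshC : ∀ t, 1 ≤ t → t ≤ T → ∀ i' i : ι, i ∈ Nbr i' →
        ∀ xh ∈ Xh (t - 1) ∩ Q (t - 1) i', ∀ x ∈ R xh ∩ Q t i,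
          ∃ yh ∈ Xh t ∩ R xh ∩ Q t i, dist yh x ≤ δX t)
    (Vh Uh : ℕ → EuclideanSpace ℝ (Fin N) → ι → ℝ)
    (hVhT : ∀ x i, Vh T x i = sInf ((fun y => c x y) '' (Xh T ∩ R x ∩ Q T i)))
    (hVht : ∀ t, 1 ≤ t → t < T → ∀ x i,
        Vh t x i = sInf ((fun y =>
          c x y + (Nbr i).sup' (hNbr i) (fun j => Vh (t + 1) y j))
            '' (Xh t ∩ R x ∩ Q t i)))
    (hUhT : ∀ x i, Uh T x i = (Nbr i).sup' (hNbr i)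
        (fun j => sInf ((fun y => c x y) '' (Xh T ∩ R x ∩ Q T j))))
    (hUht : ∀ t, 1 ≤ t → t < T → ∀ x i,
        Uh t x i = (Nbr i).sup' (hNbr i) (fun j =>
          sInf ((fun y => c x y + Uh (t + 1) y j) '' (Xh t ∩ R x ∩ Q t j))))
    (U0 Uh0 : ℝ)
    (hU0 : U0 = Finset.univ.sup' Finset.univ_nonempty
        (fun i0 : ι => sInf ((fun x0 => U 1 x0 i0) '' Q 0 i0)))
    (hUh0 : Uh0 = Finset.univ.sup' Finset.univ_nonempty
        (fun i0 : ι => sInf ((fun x0 => Uh 1 x0 i0) '' (Xh 0 ∩ Q 0 i0)))) :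
    U0 ≤ Uh0 ∧
      Uh0 ≤ U0
        + ∑ τ ∈ Finset.Ico 1 T,
            (Lc + Lc * ∑ k ∈ Finset.Icc 1 (T - (τ + 1) + 1), (1 + LΘ) ^ k) * δX τ
        + (Lc * ∑ k ∈ Finset.Icc 1 (T - 1 + 1), (1 + LΘ) ^ k) * δX 0
        + Lc * δX T := by
  classical
  -- extended value functions, zero after the horizon
  obtain ⟨W, hWdef⟩ : ∃ W : ℕ → EuclideanSpace ℝ (Fin N) → ι → ℝ,
      W = fun t x i => if t ≤ T then U t x i else 0 := ⟨_, rfl⟩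
  obtain ⟨Wh, hWhdef⟩ : ∃ W : ℕ → EuclideanSpace ℝ (Fin N) → ι → ℝ,
      W = fun t x i => if t ≤ T then Uh t x i else 0 := ⟨_, rfl⟩
  have hWend : ∀ x i, W (T + 1) x i = 0 := by intro x i; simp [hWdef]
  have hWhend : ∀ x i, Wh (T + 1) x i = 0 := by intro x i; simp [hWhdef]
  have hWrec : ∀ t, 1 ≤ t → t ≤ T → ∀ x i, W t x i = (Nbr i).sup' (hNbr i) (fun j =>
      sInf ((fun j y => c x y + W (t + 1) y j) j '' (R x ∩ Q t j))) := by
    intro t h1 h2 x i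
    rcases h2.lt_or_eq with h | rfl
    · have h3 : t + 1 ≤ T := h
      simp only [hWdef, h2, h3, if_true, hUt t h1 h]
    · simp only [hWend, add_zero]
      simp only [hWdef, le_refl, if_true, hUT]
  have hWhrec : ∀ t, 1 ≤ t → t ≤ T → ∀ x i, Wh t x i = (Nbr i).sup' (hNbr i) (fun j =>
      sInf ((fun j y => c x y + Wh (t + 1) y j) j '' (Xh t ∩ R x ∩ Q t j))) := by
    intro t h1 h2 x i
    rcases h2.lt_or_eq with h | rfl
    · have h3 : t + 1 ≤ T := h
      simp only [hWhdef, h2, h3, if_true, hUht t h1 h]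
    · simp only [hWhend, add_zero]
      simp only [hWhdef, le_refl, if_true, hUhT]
  have hW1 : ∀ x i, U 1 x i = W 1 x i := by intro x i; simp [hWdef, hT]
  have hWh1 : ∀ x i, Uh 1 x i = Wh 1 x i := by intro x i; simp [hWhdef, hT]
  have hne : ∀ t, 1 ≤ t → t ≤ T → ∀ i, ∀ x ∈ Q (t - 1) i, ∀ j ∈ Nbr i,
      (R x ∩ Q t j).Nonempty := by
    intro t h1 h2 i x hx j hj
    have := hfeas (t - 1) (by omega) i x hx j hj
    rw [Nat.sub_add_cancel h1] at this
    exact this.mono interior_subset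
  -- nonnegativity
  have hnn : ∀ n t, t + n = T + 1 → 1 ≤ t → ∀ x ∈ X, ∀ i, 0 ≤ W t x i ∧ 0 ≤ Wh t x i := by
    intro n
    induction n with
    | zero =>
      intro t ht _ x _ i
      obtain rfl : t = T + 1 := by omega
      rw [hWend, hWhend]; simp
    | succ n ih =>
      intro t ht h1 x hx i
      have h2 : t ≤ T := by omega
      rw [hWrec t h1 h2, hWhrec t h1 h2]
      constructor
      · apply aux_sup_nonneg
        intro j _ y hy
        have hyX := hQsub t h2 j hy.2
        have := (ih (t + 1) (by omega) (by omega) y hyX j).1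
        have := hcnonneg x hx y hyX
        linarith
      · apply aux_sup_nonneg
        intro j _ y hy
        have hyX := hQsub t h2 j hy.2
        have := (ih (t + 1) (by omega) (by omega) y hyX j).2
        have := hcnonneg x hx y hyX
        linarith
  obtain ⟨L, hL⟩ : ∃ L : ℕ → ℝ, L = fun n => Lc * ∑ k ∈ Finset.Icc 1 n, (1 + LΘ) ^ k :=
    ⟨_, rfl⟩
  have hL0 : L 0 = 0 := by simp [hL]
  have hLs : ∀ n, L (n + 1) = (1 + LΘ) * (Lc + L n) := by
    intro n; simp only [hL]; exact aux_geom _ _ _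
  have hLnn : ∀ n, 0 ≤ L n := by
    intro n; simp only [hL]; positivity
  -- Lipschitz continuity
  have hLip : ∀ n t, t + n = T + 1 → 1 ≤ t → ∀ i, ∀ x ∈ Q (t - 1) i, ∀ x' ∈ Q (t - 1) i,
      W t x i ≤ W t x' i + L n * dist x x' := by
    intro n
    induction n with
    | zero =>
      intro t ht _ i x _ x' _
      obtain rfl : t = T + 1 := by omega
      rw [hWend, hWend, hL0]; simp
    | succ n ih =>
      intro t ht h1 i x hx x' hx'
      have h2 : t ≤ T := by omega
      have hxX := hQsub (t - 1) (by omega) i hx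
      have hx'X := hQsub (t - 1) (by omega) i hx'
      rw [hWrec t h1 h2, hWrec t h1 h2]
      apply aux_sup_le
      · exact fun j hj => hne t h1 h2 i x' hx' j hj
      · intro j _ y hy
        have hyX := hQsub t h2 j hy.2
        have := (hnn n (t + 1) (by omega) (by omega) y hyX j).1
        have := hcnonneg x hxX y hyX
        linarith
      · intro j hj y' hy'
        have hn := hne t h1 h2 i x hx j hj
        have hn' := hne t h1 h2 i x' hx' j hj
        have hd := hΘLip t h2 j x' hx'X x hxX hn' hn
        obtain ⟨y, hy, hyd⟩ := aux_near
          ((hRcomp x' hx'X).inter_right (hQcomp t h2 j).isClosed)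
          ((hRcomp x hxX).inter_right (hQcomp t h2 j).isClosed) hn' hn hd hy'
        refine ⟨y, hy, ?_⟩
        have hyX := hQsub t h2 j hy.2
        have hy'X := hQsub t h2 j hy'.2
        have e1 := (abs_le.1 (hcLip x hxX x' hx'X y hyX y' hy'X)).2
        have e2 := ih (t + 1) (by omega) (by omega) j y hy.2 y' hy'.2
        rw [dist_comm y' y, dist_comm x' x] at hyd
        have e3 := mul_le_mul_of_nonneg_left hyd (add_nonneg hLc (hLnn n))
        have e4 := mul_nonneg (hLnn n) (dist_nonneg (x := x) (y := x'))
        rw [hLs]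
        nlinarith
  -- comparison
  have hcmp : ∀ n t, t + n = T + 1 → 1 ≤ t → ∀ i, ∀ x ∈ Xh (t - 1) ∩ Q (t - 1) i,
      W t x i ≤ Wh t x i ∧
      Wh t x i ≤ W t x i + ∑ τ ∈ Finset.Ico t (T + 1), (Lc + L (T - τ)) * δX τ := by
    intro n
    induction n with
    | zero =>
      intro t ht _ i x _
      obtain rfl : t = T + 1 := by omega
      rw [hWend, hWhend]; simp
    | succ n ih =>
      intro t ht h1 i x hx
      have h2 : t ≤ T := by omega
      have hxX := hQsub (t - 1) (by omega) i hx.2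
      rw [hWrec t h1 h2, hWhrec t h1 h2]
      constructor
      · refine (aux_sup_le _ _ _ (fun j => Xh t ∩ R x ∩ Q t j) _
          (fun j y => c x y + Wh (t + 1) y j) 0 ?_ ?_ ?_).trans_eq (add_zero _)
        · intro j hj
          obtain ⟨y, hy⟩ := hne t h1 h2 i x hx.2 j hj
          obtain ⟨z, hz, _⟩ := hmeshC t h1 h2 i j hj x hx y hy
          exact ⟨z, hz⟩
        · intro j _ y hy
          have hyX := hQsub t h2 j hy.2
          have := (hnn n (t + 1) (by omega) (by omega) y hyX j).1
          have := hcnonneg x hxX y hyX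
          linarith
        · intro j hj y hy
          refine ⟨y, ⟨hy.1.2, hy.2⟩, ?_⟩
          have := (ih (t + 1) (by omega) (by omega) j y ⟨hy.1.1, hy.2⟩).1
          linarith
      · apply aux_sup_le
        · exact fun j hj => hne t h1 h2 i x hx.2 j hj
        · intro j _ y hy
          have hyX := hQsub t h2 j hy.2
          have := (hnn n (t + 1) (by omega) (by omega) y hyX j).2
          have := hcnonneg x hxX y hyX
          linarith
        · intro j hj y hy
          obtain ⟨z, hz, hzd⟩ := hmeshC t h1 h2 i j hj x hx y hy
          refine ⟨z, hz, ?_⟩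
          have hyX := hQsub t h2 j hy.2
          have hzX := hQsub t h2 j hz.2
          have e1 := (abs_le.1 (hcLip x hxX x hxX z hzX y hyX)).2
          rw [dist_self, zero_add] at e1
          have e2 := (ih (t + 1) (by omega) (by omega) j z ⟨hz.1.1, hz.2⟩).2
          have e3 := hLip n (t + 1) (by omega) (by omega) j z hz.2 y hy.2
          have e4 := mul_le_mul_of_nonneg_left hzd (add_nonneg hLc (hLnn n))
          rw [Finset.sum_eq_sum_Ico_succ_bot (by omega : t < T + 1)]
          have e5 : T - t = n := by omega
          rw [e5]
          linarith
  have hE : U0 + ∑ τ ∈ Finset.Ico 1 T,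
            (Lc + Lc * ∑ k ∈ Finset.Icc 1 (T - (τ + 1) + 1), (1 + LΘ) ^ k) * δX τ
        + (Lc * ∑ k ∈ Finset.Icc 1 (T - 1 + 1), (1 + LΘ) ^ k) * δX 0
        + Lc * δX T
      = U0 + (∑ τ ∈ Finset.Ico 1 (T + 1), (Lc + L (T - τ)) * δX τ + L T * δX 0) := by
    rw [Finset.sum_Ico_succ_top hT, Nat.sub_self, hL0, Nat.sub_add_cancel hT]
    have : ∑ τ ∈ Finset.Ico 1 T,
            (Lc + Lc * ∑ k ∈ Finset.Icc 1 (T - (τ + 1) + 1), (1 + LΘ) ^ k) * δX τ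
        = ∑ τ ∈ Finset.Ico 1 T, (Lc + L (T - τ)) * δX τ := by
      apply Finset.sum_congr rfl
      intro τ hτ
      rw [Finset.mem_Ico] at hτ
      rw [show T - (τ + 1) + 1 = T - τ by omega, hL]
    rw [this, hL]
    ring
  rw [hE, hU0, hUh0]
  simp only [hW1, hWh1]
  constructor
  · refine (aux_sup_le _ _ (fun i => Q 0 i) (fun i => Xh 0 ∩ Q 0 i) (fun i x => W 1 x i)
      (fun i x => Wh 1 x i) 0 ?_ ?_ ?_).trans_eq (add_zero _)
    · intro i _
      obtain ⟨y, hy⟩ := hQne 0 (by omega) i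
      obtain ⟨z, hz, _⟩ := hmeshB i y hy
      exact ⟨z, hz⟩
    · intro i _ x hx
      exact (hnn T 1 (by omega) le_rfl x (hQsub 0 (by omega) i hx) i).1
    · intro i _ x hx
      refine ⟨x, hx.2, ?_⟩
      have := (hcmp T 1 (by omega) le_rfl i x hx).1
      simpa using this
  · apply aux_sup_le _ _ (fun i => Xh 0 ∩ Q 0 i) (fun i => Q 0 i) (fun i x => Wh 1 x i)
      (fun i x => W 1 x i)
    · intro i _
      exact hQne 0 (by omega) i
    · intro i _ x hx
      exact (hnn T 1 (by omega) le_rfl x (hQsub 0 (by omega) i hx.2) i).2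
    · intro i _ x hx
      obtain ⟨z, hz, hzd⟩ := hmeshB i x hx
      refine ⟨z, hz, ?_⟩
      have e1 := (hcmp T 1 (by omega) le_rfl i z hz).2
      have e2 := hLip T 1 (by omega) le_rfl i z hz.2 x hx
      have e3 := mul_le_mul_of_nonneg_left hzd (hLnn T)
      linarith
end
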